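/- arXiv:math/0305327 — 2 statements merged into one kernel-verified Lean document; each statement's English description precedes it below -/
import Mathlib

section
/- For all n ≥ 1, the following polynomial identity holds in ℤ[q]: the sum over all 321-avoiding permutations π of {1,…,2n+2} of sign(π)·q^{lis(π)} equals (q−1) times the sum over all 321-avoiding permutations π of {1,…,n} of q^{2·lis(π)+1}. -/
open scoped Classical
open Polynomial

/-- A permutation of `{1,…,n}` (modeled on `Fin n`) is 321-avoiding if there are no
indices `i < j < k` with `π i > π j > π k`. -/
def Avoids321 {n : ℕ} (π : Equiv.Perm (Fin n)) : Prop :=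
  ¬ ∃ i j k : Fin n, i < j ∧ j < k ∧ π k < π j ∧ π j < π i

/-- The length of the longest increasing subsequence of a permutation. -/
noncomputable def lis {n : ℕ} (π : Equiv.Perm (Fin n)) : ℕ :=
  sSup {k : ℕ | ∃ s : Finset (Fin n),
    (∀ i ∈ s, ∀ j ∈ s, i < j → π i < π j) ∧ s.card = k}

/-- Prepend the value `v` to the one-line notation of `π`, shifting the values `≥ v` up by one. -/
def consPerm {n : ℕ} (v : Fin (n + 1)) (π : Equiv.Perm (Fin n)) : Equiv.Perm (Fin (n + 1)) :=
  v.cycleRange⁻¹ * Equiv.Perm.decomposeFin.symm (0, π)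

@[simp]
theorem consPerm_zero {n : ℕ} (v : Fin (n + 1)) (π : Equiv.Perm (Fin n)) :
    consPerm v π 0 = v := by
  simp [consPerm, Equiv.Perm.inv_def]

@[simp]
theorem consPerm_succ {n : ℕ} (v : Fin (n + 1)) (π : Equiv.Perm (Fin n)) (j : Fin n) :
    consPerm v π j.succ = v.succAbove (π j) := by
  simp [consPerm, Equiv.Perm.inv_def]

theorem sign_consPerm {n : ℕ} (v : Fin (n + 1)) (π : Equiv.Perm (Fin n)) :
    Equiv.Perm.sign (consPerm v π) = (-1) ^ (v : ℕ) * Equiv.Perm.sign π := by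
  simp [consPerm]

theorem consPerm_bijective (n : ℕ) :
    Function.Bijective
      (fun p : Fin (n + 1) × Equiv.Perm (Fin n) => consPerm p.1 p.2) := by
  rw [Fintype.bijective_iff_injective_and_card]
  constructor
  · rintro ⟨v, π⟩ ⟨w, ρ⟩ h
    have h : consPerm v π = consPerm w ρ := h
    obtain rfl : v = w := by simpa using congrArg (fun f => f 0) h
    have : π = ρ := by
      ext j
      have := congrArg (fun f => f j.succ) h
      simp only [consPerm_succ] at this
      rw [Fin.succAbove_right_injective this]
    rw [this]
  · simp [Fintype.card_perm, Nat.factorial_succ]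

theorem val_succAbove {n : ℕ} (v : Fin (n + 1)) (w : Fin n) :
    (v.succAbove w : ℕ) = if (w : ℕ) < v then (w : ℕ) else w + 1 := by
  unfold Fin.succAbove
  simp only [Fin.lt_def, Fin.val_castSucc]
  split_ifs <;> simp

/-- `s` is the index set of an increasing subsequence of `π` with all values at least `u`. -/
def IsIncrAbove {n : ℕ} (π : Equiv.Perm (Fin n)) (u : ℕ) (s : Finset (Fin n)) : Prop :=
  (∀ i ∈ s, ∀ j ∈ s, i < j → π i < π j) ∧ ∀ i ∈ s, u ≤ π i

/-- The length of the longest increasing subsequence of `π` with all values at least `u`. -/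
noncomputable def lisAbove {n : ℕ} (π : Equiv.Perm (Fin n)) (u : ℕ) : ℕ :=
  (Finset.univ.filter (IsIncrAbove π u)).sup Finset.card

theorem IsIncrAbove.card_le {n : ℕ} {π : Equiv.Perm (Fin n)} {u : ℕ} {s : Finset (Fin n)}
    (h : IsIncrAbove π u s) : s.card ≤ lisAbove π u :=
  Finset.le_sup (f := Finset.card) (by simpa using h)

theorem exists_isIncrAbove {n : ℕ} (π : Equiv.Perm (Fin n)) (u : ℕ) :
    ∃ s, IsIncrAbove π u s ∧ s.card = lisAbove π u := by
  obtain ⟨s, hs, h⟩ := Finset.exists_mem_eq_sup (Finset.univ.filter (IsIncrAbove π u))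
    ⟨∅, by simp [IsIncrAbove]⟩ Finset.card
  exact ⟨s, by simpa using hs, h.symm⟩

theorem lis_eq_lisAbove_zero {n : ℕ} (π : Equiv.Perm (Fin n)) : lis π = lisAbove π 0 := by
  obtain ⟨s, hs, h⟩ := exists_isIncrAbove π 0
  refine IsGreatest.csSup_eq ⟨⟨s, hs.1, h⟩, ?_⟩
  rintro k ⟨t, ht, rfl⟩
  exact IsIncrAbove.card_le ⟨ht, by simp⟩

/-- Removing the first letter from a subsequence of `consPerm v π`. -/
theorem IsIncrAbove.tail {n : ℕ} {v : Fin (n + 1)} {π : Equiv.Perm (Fin n)} {u w : ℕ}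
    {s : Finset (Fin (n + 1))} (h : IsIncrAbove (consPerm v π) u s)
    (hw : ∀ j : Fin n, j.succ ∈ s → w ≤ π j) :
    IsIncrAbove π w (Finset.univ.filter fun j : Fin n => j.succ ∈ s) := by
  refine ⟨fun i hi j hj hij => ?_, fun i hi => hw i (by simpa using hi)⟩
  have := h.1 i.succ (by simpa using hi) j.succ (by simpa using hj) (by simpa using hij)
  simpa [(Fin.strictMono_succAbove v).lt_iff_lt] using this

theorem card_le_card_filter_succ {n : ℕ} (s : Finset (Fin (n + 1))) :
    s.card ≤ (Finset.univ.filter fun j : Fin n => j.succ ∈ s).card + if 0 ∈ s then 1 else 0 := by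
  have h : s ⊆ ((Finset.univ.filter fun j : Fin n => j.succ ∈ s).map (Fin.succEmb n)) ∪
      (if 0 ∈ s then {0} else ∅) := by
    intro i hi
    cases i using Fin.cases with
    | zero => simp [hi]
    | succ j => simp [hi]
  refine (Finset.card_le_card h).trans ((Finset.card_union_le _ _).trans ?_)
  rw [Finset.card_map]
  split_ifs <;> simp

/-- Shifting a subsequence of `π` into `consPerm v π`. -/
theorem IsIncrAbove.map_succ {n : ℕ} {v : Fin (n + 1)} {π : Equiv.Perm (Fin n)} {u w : ℕ}
    {s : Finset (Fin n)} (h : IsIncrAbove π w s)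
    (hu : ∀ j : Fin n, w ≤ π j → u ≤ (v.succAbove (π j) : ℕ)) :
    IsIncrAbove (consPerm v π) u (s.map (Fin.succEmb n)) := by
  refine ⟨?_, ?_⟩
  · simp only [Finset.mem_map, Fin.coe_succEmb]
    rintro _ ⟨i, hi, rfl⟩ _ ⟨j, hj, rfl⟩ hij
    simpa [(Fin.strictMono_succAbove v).lt_iff_lt] using h.1 i hi j hj (by simpa using hij)
  · simp only [Finset.mem_map, Fin.coe_succEmb]
    rintro _ ⟨i, hi, rfl⟩
    simpa using hu i (h.2 i hi)

theorem lisAbove_consPerm_of_le {n : ℕ} (v : Fin (n + 1)) (π : Equiv.Perm (Fin n)) {u : ℕ}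
    (huv : u ≤ v) :
    lisAbove (consPerm v π) u = max (lisAbove π u) (lisAbove π v + 1) := by
  apply le_antisymm
  · obtain ⟨s, hs, h⟩ := exists_isIncrAbove (consPerm v π) u
    rw [← h]
    refine (card_le_card_filter_succ s).trans ?_
    by_cases h0 : 0 ∈ s
    · rw [if_pos h0]
      refine le_max_of_le_right (Nat.add_le_add_right (hs.tail fun j hj => ?_).card_le 1)
      have := hs.1 0 h0 _ hj (Fin.succ_pos j)
      rw [consPerm_zero, consPerm_succ, Fin.lt_def, val_succAbove] at this
      split_ifs at this <;> omega
    · rw [if_neg h0]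
      refine le_max_of_le_left (hs.tail fun j hj => ?_).card_le
      have := hs.2 _ hj
      rw [consPerm_succ, val_succAbove] at this
      split_ifs at this <;> omega
  · apply max_le
    · obtain ⟨s, hs, h⟩ := exists_isIncrAbove π u
      rw [← h, ← Finset.card_map (Fin.succEmb n)]
      refine (hs.map_succ fun j hj => ?_).card_le
      rw [val_succAbove]
      split_ifs <;> omega
    · obtain ⟨s, hs, h⟩ := exists_isIncrAbove π v
      have hm : IsIncrAbove (consPerm v π) (v + 1) (s.map (Fin.succEmb n)) :=
        hs.map_succ fun j hj => by
          rw [val_succAbove]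
          split_ifs <;> omega
      have h0 : (0 : Fin (n + 1)) ∉ s.map (Fin.succEmb n) := by simp
      rw [← h, ← Finset.card_map (Fin.succEmb n), ← Finset.card_insert_of_notMem h0]
      refine IsIncrAbove.card_le ⟨fun i hi j hj hij => ?_, fun i hi => ?_⟩
      · rcases Finset.mem_insert.1 hj with rfl | hj
        · exact absurd hij (Fin.not_lt_zero i)
        rcases Finset.mem_insert.1 hi with rfl | hi
        · rw [consPerm_zero, Fin.lt_def]
          exact hm.2 j hj
        · exact hm.1 i hi j hj hij
      · rcases Finset.mem_insert.1 hi with rfl | hi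
        · rwa [consPerm_zero]
        · have := hm.2 i hi
          omega

theorem lisAbove_consPerm_zero_succ {n : ℕ} (π : Equiv.Perm (Fin n)) (u : ℕ) :
    lisAbove (consPerm 0 π) (u + 1) = lisAbove π u := by
  apply le_antisymm
  · obtain ⟨s, hs, h⟩ := exists_isIncrAbove (consPerm 0 π) (u + 1)
    have h0 : 0 ∉ s := fun h0 => by simpa using hs.2 0 h0
    rw [← h]
    refine (card_le_card_filter_succ s).trans ?_
    rw [if_neg h0]
    refine (hs.tail fun j hj => ?_).card_le
    simpa using hs.2 _ hj
  · obtain ⟨s, hs, h⟩ := exists_isIncrAbove π u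
    rw [← h, ← Finset.card_map (Fin.succEmb n)]
    exact (hs.map_succ fun j hj => by simpa using hj).card_le

/-- Every inversion of `π` has its larger value at least `u`. -/
def InversionTopsGE {n : ℕ} (π : Equiv.Perm (Fin n)) (u : ℕ) : Prop :=
  ∀ i j, i < j → π j < π i → u ≤ π i

theorem avoids321_consPerm_iff {n : ℕ} (v : Fin (n + 1)) (π : Equiv.Perm (Fin n)) :
    Avoids321 (consPerm v π) ↔ Avoids321 π ∧ InversionTopsGE π v := by
  have hlt := fun a b : Fin n => (Fin.strictMono_succAbove v).lt_iff_lt (a := a) (b := b)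
  constructor
  · intro h
    refine ⟨?_, fun i j hij hji => ?_⟩
    · rintro ⟨i, j, k, hij, hjk, hkj, hji⟩
      exact h ⟨i.succ, j.succ, k.succ, by simpa, by simpa, by simpa [hlt], by simpa [hlt]⟩
    · by_contra hv
      refine h ⟨0, i.succ, j.succ, Fin.succ_pos i, by simpa, by simpa [hlt], ?_⟩
      rw [consPerm_zero, consPerm_succ, Fin.lt_def, val_succAbove]
      split_ifs <;> omega
  · rintro ⟨h, hv⟩ ⟨i, j, k, hij, hjk, hkj, hji⟩
    obtain ⟨j, rfl⟩ := Fin.exists_succ_eq.2 (Fin.ne_zero_of_lt hij)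
    obtain ⟨k, rfl⟩ := Fin.exists_succ_eq.2 (Fin.ne_zero_of_lt hjk)
    simp only [consPerm_succ, hlt, Fin.succ_lt_succ_iff] at hkj hjk
    cases i using Fin.cases with
    | zero =>
      have := hv j k hjk hkj
      rw [consPerm_zero, consPerm_succ, Fin.lt_def, val_succAbove] at hji
      split_ifs at hji <;> omega
    | succ i =>
      simp only [consPerm_succ, hlt, Fin.succ_lt_succ_iff] at hij hji
      exact h ⟨i, j, k, hij, hjk, hkj, hji⟩

theorem inversionTopsGE_consPerm_zero {n : ℕ} (π : Equiv.Perm (Fin n)) (u : ℕ) :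
    InversionTopsGE (consPerm 0 π) (u + 1) ↔ InversionTopsGE π u := by
  constructor
  · intro h i j hij hji
    simpa using h i.succ j.succ (by simpa) (by simpa)
  · intro h i j hij hji
    obtain ⟨j, rfl⟩ := Fin.exists_succ_eq.2 (Fin.ne_zero_of_lt hij)
    cases i using Fin.cases with
    | zero => simp at hji
    | succ i => simpa using h i j (by simpa using hij) (by simpa using hji)

theorem inversionTopsGE_consPerm_iff {n : ℕ} {v : Fin (n + 1)} {π : Equiv.Perm (Fin n)}
    (hv : InversionTopsGE π v) (hv0 : v ≠ 0) (u : ℕ) :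
    InversionTopsGE (consPerm v π) u ↔ u ≤ v := by
  have hv0' : (v : ℕ) ≠ 0 := Fin.val_ne_zero_iff.2 hv0
  constructor
  · intro h
    have hn : 0 < n := by omega
    have := h 0 (π.symm ⟨0, hn⟩).succ (Fin.succ_pos _) (by
      rw [consPerm_zero, consPerm_succ, Equiv.apply_symm_apply, Fin.lt_def, val_succAbove,
        if_pos (Nat.pos_of_ne_zero hv0')]
      exact Nat.pos_of_ne_zero hv0')
    simpa using this
  · intro h i j hij hji
    obtain ⟨j, rfl⟩ := Fin.exists_succ_eq.2 (Fin.ne_zero_of_lt hij)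
    cases i using Fin.cases with
    | zero => simpa
    | succ i =>
      have := hv i j (by simpa using hij)
        (by simpa [(Fin.strictMono_succAbove v).lt_iff_lt] using hji)
      rw [consPerm_succ, val_succAbove]
      split_ifs <;> omega

/-- `b` and `c` govern which first letters may be prepended to `π` without creating a 321-pattern,
and how the length of the longest increasing subsequence changes. -/
structure HasLabel {n : ℕ} (π : Equiv.Perm (Fin n)) (b c : ℕ) : Prop where
  le : b ≤ n
  inversionTopsGE_iff : ∀ u ≤ n, InversionTopsGE π u ↔ u ≤ b
  lisAbove_add : ∀ u ≤ b, lisAbove π u + min u c = lisAbove π 0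

/-- The label after prepending `v`. -/
def nextLabel (v : ℕ) (p : ℕ × ℕ) : ℕ × ℕ :=
  if v = 0 then (p.1 + 1, p.2 + 1) else (v, min v p.2 - 1)

theorem lis_consPerm {n : ℕ} {π : Equiv.Perm (Fin n)} {b c : ℕ} (h : HasLabel π b c)
    {v : Fin (n + 1)} (hv : (v : ℕ) ≤ b) :
    lis (consPerm v π) = lis π + if (v : ℕ) = 0 ∨ c = 0 then 1 else 0 := by
  rw [lis_eq_lisAbove_zero, lis_eq_lisAbove_zero, lisAbove_consPerm_of_le v π (Nat.zero_le _)]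
  have := h.lisAbove_add v hv
  split_ifs <;> omega

theorem HasLabel.consPerm {n : ℕ} {π : Equiv.Perm (Fin n)} {b c : ℕ} (h : HasLabel π b c)
    {v : Fin (n + 1)} (hv : (v : ℕ) ≤ b) :
    HasLabel (consPerm v π) (nextLabel v (b, c)).1 (nextLabel v (b, c)).2 := by
  have hb := h.le
  have htop := (h.inversionTopsGE_iff v (by omega)).2 hv
  by_cases hv0 : v = 0
  · subst hv0
    simp only [nextLabel, Fin.val_zero, if_true]
    refine ⟨by omega, fun u hu => ?_, fun u hu => ?_⟩
    · cases u with
      | zero => simp [InversionTopsGE]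
      | succ u =>
        rw [inversionTopsGE_consPerm_zero, h.inversionTopsGE_iff u (by omega)]
        omega
    · cases u with
      | zero => simp
      | succ u =>
        have := h.lisAbove_add u (by omega)
        rw [lisAbove_consPerm_zero_succ, lisAbove_consPerm_of_le 0 π (by simp), Fin.val_zero]
        omega
  · have hv0' : (v : ℕ) ≠ 0 := Fin.val_ne_zero_iff.2 hv0
    simp only [nextLabel, if_neg hv0']
    refine ⟨by omega, fun u hu => inversionTopsGE_consPerm_iff htop hv0 u, fun u hu => ?_⟩
    have h1 := h.lisAbove_add u (by omega)
    have h2 := h.lisAbove_add v hv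
    rw [lisAbove_consPerm_of_le v π hu, lisAbove_consPerm_of_le v π (Nat.zero_le _)]
    omega

/-- The transfer operator of the generating tree of 321-avoiding permutations, where `s` records
the sign and `t` the length of the longest increasing subsequence. -/
def transfer {R : Type*} [CommRing R] (s t : R) (f : ℕ → ℕ → R) (b c : ℕ) : R :=
  t * f (b + 1) (c + 1) +
    ∑ v ∈ Finset.range b,
      s ^ (v + 1) * (if c = 0 then t else 1) * f (v + 1) (min (v + 1) c - 1)

theorem sum_consPerm {R : Type*} [CommRing R] (ε : ℤˣ →* R) (t : R) (f : ℕ → ℕ → R) {n : ℕ}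
    {π : Equiv.Perm (Fin n)} {p : ℕ × ℕ} (h : HasLabel π p.1 p.2) :
    ∑ v : Fin (n + 1), (if (v : ℕ) ≤ p.1 then
        ε (Equiv.Perm.sign (consPerm v π)) * t ^ lis (consPerm v π) *
          f (nextLabel v p).1 (nextLabel v p).2 else 0) =
      ε (Equiv.Perm.sign π) * t ^ lis π * transfer (ε (-1)) t f p.1 p.2 := by
  obtain ⟨b, c⟩ := p
  have hb := h.le
  simp only at h hb ⊢
  let g : ℕ → R := fun v => if v < b + 1 then ε (Equiv.Perm.sign π) * t ^ lis π *
    (ε (-1) ^ v * (if v = 0 ∨ c = 0 then t else 1) *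
      f (nextLabel v (b, c)).1 (nextLabel v (b, c)).2) else 0
  have key : ∀ v : Fin (n + 1), (if (v : ℕ) ≤ b then
        ε (Equiv.Perm.sign (consPerm v π)) * t ^ lis (consPerm v π) *
          f (nextLabel v (b, c)).1 (nextLabel v (b, c)).2 else 0) = g v := by
    intro v
    simp only [g, Nat.lt_succ_iff]
    split_ifs with h1 h2
    · rw [lis_consPerm h h1, if_pos h2, sign_consPerm, map_mul, map_pow]
      ring
    · rw [lis_consPerm h h1, if_neg h2, sign_consPerm, map_mul, map_pow]
      ring
    · rfl
  rw [Finset.sum_congr rfl fun v _ => key v, Fin.sum_univ_eq_sum_range g, ← Finset.sum_filter,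
    ← Finset.mul_sum]
  have hr : (Finset.range (n + 1)).filter (· < b + 1) = Finset.range (b + 1) := by
    ext v
    simp
    omega
  rw [hr, Finset.sum_range_succ', transfer]
  simp [nextLabel, add_comm]

theorem exists_label_sum_eq {R : Type*} [CommRing R] (ε : ℤˣ →* R) (t : R) (n : ℕ) :
    ∃ ℓ : Equiv.Perm (Fin n) → ℕ × ℕ,
      (∀ π, Avoids321 π → HasLabel π (ℓ π).1 (ℓ π).2) ∧
      ∀ f : ℕ → ℕ → R,
        ∑ π ∈ Finset.univ.filter (fun π : Equiv.Perm (Fin n) => Avoids321 π),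
          ε (Equiv.Perm.sign π) * t ^ lis π * f (ℓ π).1 (ℓ π).2 =
        (transfer (ε (-1)) t)^[n] f 0 0 := by
  induction n with
  | zero =>
    refine ⟨fun _ => (0, 0), fun π _ => ⟨le_rfl, fun u hu => ?_, fun u hu => ?_⟩, fun f => ?_⟩
    · simp [hu, InversionTopsGE]
    · simp_all
    · have hav : ∀ π : Equiv.Perm (Fin 0), Avoids321 π := fun π ⟨i, _⟩ => i.elim0
      have hl : ∀ π : Equiv.Perm (Fin 0), lis π = 0 := fun π => by
        obtain ⟨s, -, hs⟩ := exists_isIncrAbove π 0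
        rw [lis_eq_lisAbove_zero, ← hs, Subsingleton.elim s ∅, Finset.card_empty]
      simp [hav, hl]
  | succ n ih =>
    obtain ⟨ℓ, hℓ, hsum⟩ := ih
    let e := Equiv.ofBijective _ (consPerm_bijective n)
    have he : ∀ v π, e (v, π) = consPerm v π := fun v π => rfl
    have hav : ∀ v π, Avoids321 (consPerm v π) ↔ Avoids321 π ∧ (v : ℕ) ≤ (ℓ π).1 := by
      intro v π
      rw [avoids321_consPerm_iff]
      refine and_congr_right fun h => ?_
      exact (hℓ π h).inversionTopsGE_iff v (by omega)
    refine ⟨fun π => nextLabel (e.symm π).1 (ℓ (e.symm π).2), fun π hπ => ?_, fun f => ?_⟩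
    · obtain ⟨⟨v, π⟩, rfl⟩ := e.surjective π
      rw [he, hav] at hπ
      simp only [Equiv.symm_apply_apply]
      exact (hℓ π hπ.1).consPerm hπ.2
    · rw [Function.iterate_succ_apply, ← hsum, Finset.sum_filter, ← e.sum_comp,
        Fintype.sum_prod_type_right, Finset.sum_filter]
      refine Finset.sum_congr rfl fun π _ => ?_
      simp only [Equiv.symm_apply_apply]
      simp only [he, hav]
      split_ifs with hπ
      · rw [← sum_consPerm ε t f (hℓ π hπ)]
        simp [hπ]
      · simp [hπ]

theorem sum_avoids321_eq_transfer {R : Type*} [CommRing R] (ε : ℤˣ →* R) (t : R) (n : ℕ) :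
    ∑ π ∈ Finset.univ.filter (fun π : Equiv.Perm (Fin n) => Avoids321 π),
        ε (Equiv.Perm.sign π) * t ^ lis π =
      (transfer (ε (-1)) t)^[n] (fun _ _ => 1) 0 0 := by
  obtain ⟨ℓ, -, h⟩ := exists_label_sum_eq ε t n
  simpa using h fun _ _ => 1

section Intertwining

variable {R : Type*} [CommRing R]

/-- The part of `transfer` coming from nonzero first letters. -/
def transferTail (s t : R) (f : ℕ → ℕ → R) (b c : ℕ) : R :=
  ∑ v ∈ Finset.range b, s ^ (v + 1) * (if c = 0 then t else 1) * f (v + 1) (min (v + 1) c - 1)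

theorem transfer_eq (s t : R) (f : ℕ → ℕ → R) (b c : ℕ) :
    transfer s t f b c = t * f (b + 1) (c + 1) + transferTail s t f b c :=
  rfl

@[simp]
theorem transferTail_zero (s t : R) (f : ℕ → ℕ → R) (c : ℕ) : transferTail s t f 0 c = 0 :=
  rfl

theorem transferTail_succ (s t : R) (f : ℕ → ℕ → R) (b c : ℕ) :
    transferTail s t f (b + 1) (c + 1) =
      transferTail s t f b (c + 1) + s ^ (b + 1) * f (b + 1) (min b c) := by
  have : min (b + 1) (c + 1) - 1 = min b c := by omega
  rw [transferTail, Finset.sum_range_succ, ← transferTail, this]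
  simp

theorem transferTail_zero_right (s t : R) (f : ℕ → ℕ → R) (b : ℕ) :
    transferTail s t f b 0 = t * transferTail s t f b 1 := by
  rw [transferTail, transferTail, Finset.mul_sum]
  refine Finset.sum_congr rfl fun v _ => ?_
  simp
  ring

theorem transferTail_succ_right (s t : R) (f : ℕ → ℕ → R) {b c : ℕ} (h : b ≤ c + 1) :
    transferTail s t f b (c + 2) = transferTail s t f b (c + 1) := by
  refine Finset.sum_congr rfl fun v hv => ?_
  have hv := Finset.mem_range.1 hv
  have : min (v + 1) (c + 2) - 1 = min (v + 1) (c + 1) - 1 := by omega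
  rw [this]
  simp

theorem transferTail_neg_one_two_mul_add_two (q : R) (f : ℕ → ℕ → R) (b c : ℕ) :
    transferTail (-1) q f (2 * b + 2) (c + 1) = transferTail (-1) q f (2 * b) (c + 1) -
      f (2 * b + 1) (min (2 * b) c) + f (2 * b + 2) (min (2 * b + 1) c) := by
  rw [transferTail_succ, transferTail_succ]
  have h1 : (-1 : R) ^ (2 * b + 1) = -1 := by simp [pow_succ]
  have h2 : (-1 : R) ^ (2 * b + 1 + 1) = 1 := by simp [pow_succ]
  rw [h1, h2]
  ring

theorem transferTail_neg_one_two_mul_add_one (q : R) (f : ℕ → ℕ → R) (b c : ℕ) :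
    transferTail (-1) q f (2 * b + 1) (c + 1) =
      transferTail (-1) q f (2 * b) (c + 1) - f (2 * b + 1) (min (2 * b) c) := by
  have h : (-1 : R) ^ (2 * b) = 1 := by simp
  rw [transferTail_succ, pow_succ, h]
  ring

/-- `f` is the function of signed weights that corresponds to the function `g` of unsigned
weights. -/
structure SignedLift (q : R) (f g : ℕ → ℕ → R) : Prop where
  even_even : ∀ b d, d ≤ b → f (2 * b) (2 * d) = q * g b d
  even_odd : ∀ b d, d < b →
    (1 + q) * f (2 * b) (2 * d + 1) = q * g b d + q ^ 2 * g b (d + 1)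
  odd_zero : ∀ b, f (2 * b + 1) 0 = 0
  odd_odd : ∀ b d, d ≤ b → (1 + q) * f (2 * b + 1) (2 * d + 1) = q ^ 2 * g b (d + 1) - g b d
  odd_even : ∀ b d, d < b → (1 + q) * f (2 * b + 1) (2 * d + 2) = q ^ 2 * g b (d + 1) - g b d
  stable : ∀ b d, b ≤ d → g b (d + 1) = g b d

namespace SignedLift

variable {q : R} {f g : ℕ → ℕ → R}

theorem transferTail_odd_odd (h : SignedLift q f g) (b d : ℕ) :
    (1 + q) * transferTail (-1) q f (2 * b + 1) (2 * d + 1) =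
      transferTail 1 (q ^ 2) g b d + q * transferTail 1 (q ^ 2) g b (d + 1) := by
  induction b with
  | zero =>
    have := h.odd_zero 0
    simp [transferTail_succ] at this ⊢
    simp [this]
  | succ b ih =>
    have e : transferTail (-1) q f (2 * (b + 1) + 1) (2 * d + 1) =
        transferTail (-1) q f (2 * b + 1) (2 * d + 1) + f (2 * (b + 1)) (min (2 * b + 1) (2 * d)) -
          f (2 * (b + 1) + 1) (min (2 * b + 2) (2 * d)) := by
      have h1 := transferTail_neg_one_two_mul_add_one q f (b + 1) (2 * d)
      have h2 := transferTail_neg_one_two_mul_add_two q f b (2 * d)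
      have h3 := transferTail_neg_one_two_mul_add_one q f b (2 * d)
      simp only [mul_add, mul_one] at h1 h2 h3 ⊢
      linear_combination h1 + h2 - h3
    rw [e, transferTail_succ _ _ _ b d]
    rcases d with _ | d
    · have h1 := h.even_even (b + 1) 0 (by omega)
      have h2 := h.odd_zero (b + 1)
      simp only [transferTail_zero_right _ _ _ (b + 1), transferTail_zero_right _ _ _ b,
        transferTail_succ _ _ _ b 0, mul_zero, Nat.min_zero, zero_add] at ih h1 ⊢
      linear_combination ih + (1 + q) * h1 - (1 + q) * h2
    · rw [transferTail_succ _ _ _ b d]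
      rcases lt_or_ge b (d + 1) with hb | hb
      · have h1 := h.even_odd (b + 1) b (by omega)
        have h2 := h.odd_even (b + 1) b (by omega)
        rw [min_eq_left (by omega : 2 * b + 1 ≤ 2 * (d + 1)),
          min_eq_left (by omega : 2 * b + 2 ≤ 2 * (d + 1)), min_eq_left (by omega : b ≤ d),
          min_eq_left (by omega : b ≤ d + 1)]
        linear_combination ih + h1 - h2
      · have h1 := h.even_even (b + 1) (d + 1) (by omega)
        have h2 := h.odd_even (b + 1) d (by omega)
        rw [min_eq_right (by omega : 2 * (d + 1) ≤ 2 * b + 1),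
          min_eq_right (by omega : 2 * (d + 1) ≤ 2 * b + 2), min_eq_right (by omega : d ≤ b),
          min_eq_right hb]
        simp only [mul_add, mul_one] at h1 h2 ih ⊢
        linear_combination ih + (1 + q) * h1 - h2

theorem transfer_odd_odd (h : SignedLift q f g) {b d : ℕ} (hd : d ≤ b) :
    (1 + q) * transfer (-1) q f (2 * b + 1) (2 * d + 1) =
      transferTail 1 (q ^ 2) g b d + q * transferTail 1 (q ^ 2) g b (d + 1) +
        (1 + q) * q ^ 2 * g (b + 1) (d + 1) := by
  have h1 := h.even_even (b + 1) (d + 1) (by omega)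
  have h2 := h.transferTail_odd_odd b d
  rw [transfer_eq]
  simp only [mul_add, mul_one] at h1 h2 ⊢
  linear_combination h2 + q * (1 + q) * h1

theorem transfer_even_one (h : SignedLift q f g) {b : ℕ} (hb : 0 < b) :
    (1 + q) * transfer (-1) q f (2 * b) 1 =
      transferTail 1 (q ^ 2) g b 0 + q * transferTail 1 (q ^ 2) g b 1 +
        q * (q ^ 2 * g b 1 - g b 0) := by
  have h1 := h.odd_even b 0 hb
  have h2 := h.transferTail_odd_odd b 0
  have h3 := transferTail_neg_one_two_mul_add_one q f b 0
  have h4 := h.odd_zero b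
  simp only [mul_zero, zero_add, Nat.min_zero] at h1 h2 h3
  rw [transfer_eq]
  linear_combination q * h1 + h2 - (1 + q) * h3 + (1 + q) * h4

theorem transfer_even_odd (h : SignedLift q f g) {b d : ℕ} (hd : d + 1 < b) :
    (1 + q) * transfer (-1) q f (2 * b) (2 * d + 3) =
      transferTail 1 (q ^ 2) g b (d + 1) + q * transferTail 1 (q ^ 2) g b (d + 2) +
        q * (q ^ 2 * g b (d + 2) - g b (d + 1)) + (q ^ 2 * g b (d + 1) - g b d) := by
  have h1 := h.odd_even b (d + 1) hd
  have h2 := h.transferTail_odd_odd b (d + 1)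
  have h3 := transferTail_neg_one_two_mul_add_one q f b (2 * d + 2)
  have h4 := h.odd_even b d (by omega)
  rw [min_eq_right (by omega)] at h3
  rw [transfer_eq]
  simp only [mul_add, mul_one] at h1 h2 h3 ⊢
  linear_combination q * h1 + h2 - (1 + q) * h3 + h4

theorem transfer_one (q : R) : SignedLift q (transfer (-1) q fun _ _ => 1) fun _ _ => 1 := by
  have h1 : ∀ b c, transferTail (-1) q (fun _ _ => 1) (2 * b) (c + 1) = 0 := by
    intro b c
    induction b with
    | zero => simp
    | succ b ih => rw [mul_add, mul_one, transferTail_neg_one_two_mul_add_two, ih]; ring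
  have h2 : ∀ b c, transferTail (-1) q (fun _ _ => 1) (2 * b + 1) (c + 1) = -1 := by
    intro b c
    rw [transferTail_neg_one_two_mul_add_one, h1]
    ring
  refine ⟨fun b d _ => ?_, fun b d _ => ?_, fun b => ?_, fun b d _ => ?_, fun b d _ => ?_,
    fun _ _ _ => rfl⟩
  · rw [transfer_eq]
    rcases d with _ | d
    · rw [mul_zero, transferTail_zero_right, h1 b 0]
      ring
    · rw [mul_add, mul_one, h1 b (2 * d + 1)]
      ring
  · rw [transfer_eq, h1]
    ring
  · rw [transfer_eq, transferTail_zero_right, h2 b 0]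
    ring
  · rw [transfer_eq, h2]
    ring
  · rw [transfer_eq, h2 b (2 * d + 1)]
    ring

variable [IsDomain R]

theorem transferTail_odd_even (h : SignedLift q f g) (hq : 1 + q ≠ 0) (b d : ℕ) :
    transferTail (-1) q f (2 * b + 1) (2 * d) = transferTail 1 (q ^ 2) g b d := by
  apply mul_left_cancel₀ hq
  rcases d with _ | d
  · have := h.transferTail_odd_odd b 0
    rw [mul_zero, transferTail_zero_right]
    simp only [transferTail_zero_right (1 : R), mul_zero, zero_add] at this ⊢
    linear_combination q * this
  induction b with
  | zero =>
    have := h.odd_zero 0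
    simp [mul_add, transferTail_succ] at this ⊢
    simp [this]
  | succ b ih =>
    have e : transferTail (-1) q f (2 * (b + 1) + 1) (2 * d + 1 + 1) =
        transferTail (-1) q f (2 * b + 1) (2 * d + 1 + 1) +
          f (2 * (b + 1)) (min (2 * b + 1) (2 * d + 1)) -
          f (2 * (b + 1) + 1) (min (2 * b + 2) (2 * d + 1)) := by
      have h1 := transferTail_neg_one_two_mul_add_one q f (b + 1) (2 * d + 1)
      have h2 := transferTail_neg_one_two_mul_add_two q f b (2 * d + 1)
      have h3 := transferTail_neg_one_two_mul_add_one q f b (2 * d + 1)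
      simp only [mul_add, mul_one] at h1 h2 h3 ⊢
      linear_combination h1 + h2 - h3
    have hd : 2 * (d + 1) = 2 * d + 1 + 1 := by ring
    rw [hd] at ih ⊢
    rw [e, transferTail_succ _ _ _ b d]
    rcases lt_or_ge b d with hb | hb
    · have h1 := h.even_odd (b + 1) b (by omega)
      have h2 := h.odd_even (b + 1) b (by omega)
      rw [min_eq_left (by omega : 2 * b + 1 ≤ 2 * d + 1),
        min_eq_left (by omega : 2 * b + 2 ≤ 2 * d + 1), min_eq_left (by omega : b ≤ d)]
      linear_combination ih + h1 - h2
    · have h1 := h.even_odd (b + 1) d (by omega)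
      have h2 := h.odd_odd (b + 1) d (by omega)
      rw [min_eq_right (by omega : 2 * d + 1 ≤ 2 * b + 1),
        min_eq_right (by omega : 2 * d + 1 ≤ 2 * b + 2), min_eq_right (by omega : d ≤ b)]
      linear_combination ih + h1 - h2

theorem transfer_odd_even (h : SignedLift q f g) (hq : 1 + q ≠ 0) {b d : ℕ} (hd : d ≤ b) :
    (1 + q) * transfer (-1) q f (2 * b + 1) (2 * d) =
      (1 + q) * transferTail 1 (q ^ 2) g b d + q ^ 2 * g (b + 1) d +
        q ^ 3 * g (b + 1) (d + 1) := by
  have h1 := h.even_odd (b + 1) d (by omega)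
  rw [transfer_eq, h.transferTail_odd_even hq]
  simp only [mul_add, mul_one] at h1 ⊢
  linear_combination q * h1

theorem transfer_even_zero (h : SignedLift q f g) (hq : 1 + q ≠ 0) (b : ℕ) :
    (1 + q) * transfer (-1) q f (2 * b) 0 =
      (1 + q) * transferTail 1 (q ^ 2) g b 0 + q * (q ^ 2 * g b 1 - g b 0) := by
  have h1 := h.odd_odd b 0 (by omega)
  have h2 := h.transferTail_odd_even hq b 0
  have h3 := transferTail_neg_one_two_mul_add_one q f b 0
  have h4 := h.odd_zero b
  rw [mul_zero, transferTail_zero_right, h3, Nat.min_zero, h4, sub_zero,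
    ← transferTail_zero_right] at h2
  rw [transfer_eq, h2]
  linear_combination q * h1

theorem transfer_even_even (h : SignedLift q f g) (hq : 1 + q ≠ 0) {b d : ℕ} (hd : d < b) :
    (1 + q) * transfer (-1) q f (2 * b) (2 * d + 2) =
      (1 + q) * transferTail 1 (q ^ 2) g b (d + 1) +
        q * (q ^ 2 * g b (d + 2) - g b (d + 1)) + (q ^ 2 * g b (d + 1) - g b d) := by
  have h1 := h.odd_odd b (d + 1) (by omega)
  have h2 := h.transferTail_odd_even hq b (d + 1)
  have h3 := transferTail_neg_one_two_mul_add_one q f b (2 * d + 1)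
  have h4 := h.odd_odd b d (by omega)
  rw [min_eq_right (by omega)] at h3
  rw [transfer_eq]
  simp only [mul_add, mul_one] at h1 h2 h3 ⊢
  linear_combination q * h1 + (1 + q) * h2 - (1 + q) * h3 + h4

theorem transfer_diagonal (h : SignedLift q f g) (hq : 1 + q ≠ 0) (b : ℕ) :
    transfer (-1) q f (2 * b + 2) (2 * b + 1) = transfer (-1) q f (2 * b + 1) (2 * b) := by
  apply mul_left_cancel₀ hq
  have h2 := h.transfer_odd_even hq le_rfl (b := b)
  rcases b with _ | b
  · have h1 := h.transfer_even_one Nat.one_pos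
    simp only [transferTail_zero_right (1 : R), transferTail_succ (1 : R) _ _ 0, mul_zero,
      zero_add, mul_one, transferTail_zero, Nat.min_zero] at h1 h2 ⊢
    linear_combination h1 - h2
  · have h1 := h.transfer_even_odd (b := b + 2) (d := b) (by omega)
    have h3 := transferTail_succ_right 1 (q ^ 2) g (le_refl (b + 1))
    rw [transferTail_succ _ _ _ (b + 1) b, transferTail_succ _ _ _ (b + 1) (b + 1),
      min_self, min_eq_right (by omega : b ≤ b + 1), h3] at h1
    simp only [mul_add, mul_one, one_pow, one_mul, add_assoc, Nat.reduceAdd,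
      Nat.reduceMul] at h1 h2 ⊢
    linear_combination h1 - h2

theorem transferTail_transfer_odd (h : SignedLift q f g) (hq : 1 + q ≠ 0) (b d : ℕ) :
    (1 + q) * transferTail (-1) q (transfer (-1) q f) (2 * b) (2 * d + 1) =
      q * (transferTail 1 (q ^ 2) g b d - transferTail 1 (q ^ 2) g b (d + 1)) := by
  induction b with
  | zero => simp
  | succ b ih =>
    rw [mul_add, mul_one, transferTail_neg_one_two_mul_add_two, transferTail_succ _ _ _ b d]
    rcases d with _ | d
    · have h1 := h.transfer_even_zero hq (b + 1)
      have h2 := h.transfer_odd_even hq (Nat.zero_le b)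
      simp only [transferTail_zero_right (1 : R), transferTail_succ (1 : R) _ _ b 0, mul_zero,
        zero_add, Nat.min_zero, mul_add, mul_one] at h1 h2 ih ⊢
      linear_combination ih + h1 - h2
    rw [transferTail_succ _ _ _ b d]
    rcases lt_or_ge b (d + 1) with hb | hb
    · rw [min_eq_left (by omega : 2 * b ≤ 2 * (d + 1)),
        min_eq_left (by omega : 2 * b + 1 ≤ 2 * (d + 1)), min_eq_left (by omega : b ≤ d),
        min_eq_left hb.le]
      linear_combination ih + (1 + q) * h.transfer_diagonal hq b
    · have h1 := h.transfer_even_even hq (b := b + 1) (d := d) (by omega)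
      have h2 := h.transfer_odd_even hq hb
      rw [min_eq_right (by omega : 2 * (d + 1) ≤ 2 * b),
        min_eq_right (by omega : 2 * (d + 1) ≤ 2 * b + 1), min_eq_right (by omega : d ≤ b),
        min_eq_right hb]
      rw [transferTail_succ _ _ _ b d, min_eq_right (by omega : d ≤ b)] at h1
      simp only [mul_add, mul_one, one_pow, one_mul] at h1 h2 ih ⊢
      linear_combination ih + h1 - h2

theorem transferTail_transfer_even (h : SignedLift q f g) (hq : 1 + q ≠ 0) (b d : ℕ) :
    (1 + q) * transferTail (-1) q (transfer (-1) q f) (2 * b) (2 * d + 2) =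
      q ^ 2 * (transferTail 1 (q ^ 2) g b (d + 1) - transferTail 1 (q ^ 2) g b (d + 2)) := by
  induction b with
  | zero => simp
  | succ b ih =>
    rw [mul_add, mul_one, transferTail_neg_one_two_mul_add_two, transferTail_succ _ _ _ b d,
      transferTail_succ _ _ _ b (d + 1)]
    rcases lt_or_ge b (d + 1) with hb | hb
    · rw [min_eq_left (by omega : 2 * b ≤ 2 * d + 1),
        min_eq_left (by omega : 2 * b + 1 ≤ 2 * d + 1), min_eq_left (by omega : b ≤ d),
        min_eq_left hb.le]
      linear_combination ih + (1 + q) * h.transfer_diagonal hq b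
    · have h2 := h.transfer_odd_odd (by omega : d ≤ b)
      rw [min_eq_right (by omega : 2 * d + 1 ≤ 2 * b),
        min_eq_right (by omega : 2 * d + 1 ≤ 2 * b + 1), min_eq_right (by omega : d ≤ b),
        min_eq_right hb]
      rcases d with _ | d
      · have h1 := h.transfer_even_one b.succ_pos
        simp only [transferTail_zero_right (1 : R), transferTail_succ (1 : R) _ _ b 0, mul_zero,
          zero_add, Nat.min_zero, mul_add, mul_one, Nat.succ_eq_add_one] at h1 h2 ih ⊢
        linear_combination ih + h1 - h2
      · have h1 := h.transfer_even_odd (b := b + 1) (d := d) (by omega)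
        rw [transferTail_succ _ _ _ b d, min_eq_right (by omega : d ≤ b),
          transferTail_succ _ _ _ b (d + 1), min_eq_right (by omega : d + 1 ≤ b)] at h1
        simp only [mul_add, mul_one, one_pow, one_mul, add_assoc, Nat.reduceAdd] at h1 h2 ih ⊢
        linear_combination ih + h1 - h2

theorem transfer_transfer (h : SignedLift q f g) (hq : 1 + q ≠ 0) :
    SignedLift q (transfer (-1) q (transfer (-1) q f)) (transfer 1 (q ^ 2) g) where
  even_even b d hd := by
    apply mul_left_cancel₀ hq
    have h1 := h.transfer_odd_odd hd
    rw [transfer_eq _ _ (transfer _ _ _), transfer_eq _ _ g]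
    rcases d with _ | d
    · have h2 := h.transferTail_transfer_odd hq b 0
      rw [mul_zero, transferTail_zero_right]
      simp only [transferTail_zero_right (1 : R), mul_zero, zero_add] at h1 h2 ⊢
      linear_combination q * h1 + q * h2
    · have h2 := h.transferTail_transfer_even hq b d
      simp only [mul_add, mul_one] at h1 h2 ⊢
      linear_combination q * h1 + h2
  even_odd b d hd := by
    have h1 := h.transfer_odd_even hq (by omega : d + 1 ≤ b)
    have h2 := h.transferTail_transfer_odd hq b d
    rw [transfer_eq _ _ (transfer _ _ _), transfer_eq _ _ g, transfer_eq _ _ g]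
    simp only [mul_add, mul_one] at h1 h2 ⊢
    linear_combination q * h1 + h2
  odd_zero b := by
    apply mul_left_cancel₀ hq
    have h1 := h.transfer_even_one b.succ_pos
    have h2 := h.transferTail_transfer_odd hq b 0
    have h3 := h.transfer_odd_even hq (Nat.zero_le b)
    have h4 := transferTail_neg_one_two_mul_add_one q (transfer (-1) q f) b 0
    rw [transfer_eq _ _ (transfer _ _ _), transferTail_zero_right]
    simp only [transferTail_zero_right (1 : R), transferTail_succ (1 : R) _ _ b 0, mul_zero,
      zero_add, Nat.min_zero, mul_add, mul_one, Nat.succ_eq_add_one] at h1 h2 h3 h4 ⊢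
    linear_combination q * h1 + q * h2 - q * h3 + q * (1 + q) * h4
  odd_odd b d hd := by
    have h1 := h.transfer_even_even hq (b := b + 1) (d := d) (by omega)
    have h2 := h.transferTail_transfer_odd hq b d
    have h3 := h.transfer_odd_even hq hd
    have h4 := transferTail_neg_one_two_mul_add_one q (transfer (-1) q f) b (2 * d)
    rw [min_eq_right (by omega)] at h4
    rw [transferTail_succ _ _ _ b d, min_eq_right hd] at h1
    rw [transfer_eq _ _ (transfer _ _ _), transfer_eq _ _ g, transfer_eq _ _ g]
    simp only [mul_add, mul_one, one_pow, one_mul] at h1 h2 h3 h4 ⊢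
    linear_combination q * h1 + h2 - h3 + (1 + q) * h4
  odd_even b d hd := by
    have h1 := h.transfer_even_odd (b := b + 1) (d := d) (by omega)
    have h2 := h.transferTail_transfer_even hq b d
    have h3 := h.transfer_odd_odd hd.le
    have h4 := transferTail_neg_one_two_mul_add_one q (transfer (-1) q f) b (2 * d + 1)
    rw [min_eq_right (by omega)] at h4
    rw [transferTail_succ _ _ _ b d, min_eq_right hd.le, transferTail_succ _ _ _ b (d + 1),
      min_eq_right (by omega)] at h1
    rw [transfer_eq _ _ (transfer _ _ _), transfer_eq _ _ g, transfer_eq _ _ g]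
    simp only [mul_add, mul_one, one_pow, one_mul, add_assoc, Nat.reduceAdd] at h1 h2 h3 h4 ⊢
    linear_combination q * h1 + h2 - h3 + (1 + q) * h4
  stable b d hd := by
    rw [transfer_eq, transfer_eq, h.stable (b + 1) (d + 1) (by omega)]
    rcases d with _ | d
    · obtain rfl : b = 0 := by omega
      simp
    · rw [transferTail_succ_right _ _ _ hd]

theorem iterate_transfer (hq : 1 + q ≠ 0) (n : ℕ) :
    SignedLift q ((transfer (-1) q)^[2 * n + 1] fun _ _ => 1)
      ((transfer 1 (q ^ 2))^[n] fun _ _ => 1) := by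
  induction n with
  | zero => exact transfer_one q
  | succ n ih =>
    have := ih.transfer_transfer hq
    rwa [← Function.iterate_succ_apply' (transfer (-1) q),
      ← Function.iterate_succ_apply' (transfer (-1) q),
      ← Function.iterate_succ_apply' (transfer 1 (q ^ 2))] at this

end SignedLift

theorem iterate_transfer_neg_one_two_mul_add_two [IsDomain R] {q : R} (hq : 1 + q ≠ 0) (n : ℕ) :
    (transfer (-1) q)^[2 * n + 2] (fun _ _ => 1) 0 0 =
      (q - 1) * (q * (transfer 1 (q ^ 2))^[n] (fun _ _ => 1) 0 0) := by
  have h := SignedLift.iterate_transfer hq n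
  have h1 := h.odd_odd 0 0 le_rfl
  have h2 := h.stable 0 0 le_rfl
  rw [Function.iterate_succ_apply', transfer_eq, transferTail_zero]
  simp only [mul_zero, zero_add] at h1 h2 ⊢
  apply mul_left_cancel₀ hq
  linear_combination q * h1 + q ^ 3 * h2

end Intertwining

theorem sign_balance_lis_even (n : ℕ) (hn : 1 ≤ n) :
    ∑ π ∈ Finset.univ.filter (fun π : Equiv.Perm (Fin (2 * n + 2)) => Avoids321 π),
        C ((Equiv.Perm.sign π : ℤ)) * X ^ lis π
      =
    ((X : Polynomial ℤ) - 1) *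
      ∑ π ∈ Finset.univ.filter (fun π : Equiv.Perm (Fin n) => Avoids321 π),
        (X : Polynomial ℤ) ^ (2 * lis π + 1) := by
  have hq : (1 : ℤ[X]) + X ≠ 0 := by
    rw [add_comm]
    exact (monic_X_add_C (1 : ℤ)).ne_zero
  have h1 : ∑ π ∈ Finset.univ.filter (fun π : Equiv.Perm (Fin (2 * n + 2)) => Avoids321 π),
      C ((Equiv.Perm.sign π : ℤ)) * X ^ lis π =
        (transfer (-1) X)^[2 * n + 2] (fun _ _ => 1) 0 0 := by
    simpa [-Function.iterate_succ] using sum_avoids321_eq_transfer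
      ((C : ℤ →+* ℤ[X]).toMonoidHom.comp (Units.coeHom ℤ)) X (2 * n + 2)
  have h2 : ∑ π ∈ Finset.univ.filter (fun π : Equiv.Perm (Fin n) => Avoids321 π),
      ((X : ℤ[X]) ^ 2) ^ lis π = (transfer 1 (X ^ 2))^[n] (fun _ _ => 1) 0 0 := by
    simpa using sum_avoids321_eq_transfer (1 : ℤˣ →* ℤ[X]) (X ^ 2) n
  simp only [pow_succ _ (2 * _), pow_mul, ← Finset.sum_mul, h2]
  rw [h1, iterate_transfer_neg_one_two_mul_add_two hq, mul_comm X]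
end

section
/- For all n and k, e(2n+1, 2k+1) − o(2n+1, 2k+1) = b(n,k)², where b(n,k) = ((2k−n+1)/(n+1))·C(n+1,k+1) is the ballot number. -/
open scoped Classical
open Polynomial

/-- The ballot number `b(n,k) = ((2k−n+1)/(n+1))·C(n+1,k+1)`. -/
def ballotNum (n k : ℕ) : ℕ := ((2 * k + 1 - n) * Nat.choose (n + 1) (k + 1)) / (n + 1)

/-- `eCount n k` is the number of even 321-avoiding permutations of `{1,…,n}`
whose longest increasing subsequence has length `k`. -/
noncomputable def eCount (n k : ℕ) : ℕ :=
  Nat.card {π : Equiv.Perm (Fin n) // Avoids321 π ∧ lis π = k ∧ Equiv.Perm.sign π = 1}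

/-- `oCount n k` is the number of odd 321-avoiding permutations of `{1,…,n}`
whose longest increasing subsequence has length `k`. -/
noncomputable def oCount (n k : ℕ) : ℕ :=
  Nat.card {π : Equiv.Perm (Fin n) // Avoids321 π ∧ lis π = k ∧ Equiv.Perm.sign π = -1}

/-- Signed count of standard Young tableaux of shape `(p, q)`, the sign being that of the row
reading word. -/
def imb : ℕ → ℕ → ℤ
  | _, 0 => 1
  | 0, _ + 1 => 0
  | p + 1, q + 1 => if q ≤ p then (-1) ^ (q + 1) * imb p (q + 1) + imb (p + 1) q else 0

theorem imb_zero_right (p : ℕ) : imb p 0 = 1 := by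
  cases p <;> simp [imb]

theorem imb_eq_zero {p q : ℕ} (h : p < q) : imb p q = 0 := by
  rcases p with _ | p <;> rcases q with _ | q <;> simp_all [imb]

theorem imb_succ_succ {p q : ℕ} (h : q ≤ p) :
    imb (p + 1) (q + 1) = (-1) ^ (q + 1) * imb p (q + 1) + imb (p + 1) q := by
  rw [imb, if_pos h]

theorem imb_odd_even_rec {k m : ℕ} (h : m ≤ k) :
    imb (2 * (k + 1) + 1) (2 * (m + 1)) =
      imb (2 * k + 1) (2 * (m + 1)) + imb (2 * (k + 1) + 1) (2 * m) := by
  have e : (-1 : ℤ) ^ (2 * m) = 1 := by simp [pow_mul]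
  have h1 := imb_succ_succ (p := 2 * k + 2) (q := 2 * m + 1) (by omega)
  have h2 := imb_succ_succ (p := 2 * k + 2) (q := 2 * m) (by omega)
  have h3 := imb_succ_succ (p := 2 * k + 1) (q := 2 * m + 1) (by omega)
  simp only [pow_succ, e] at h1 h2 h3
  rw [show 2 * (k + 1) + 1 = 2 * k + 2 + 1 by ring, show 2 * (m + 1) = 2 * m + 1 + 1 by ring]
  linarith

theorem imb_odd_even_eq_choose (k m : ℕ) (h : m ≤ k + 1) :
    imb (2 * k + 1) (2 * m) = ((k + m).choose k : ℤ) - (k + m).choose (k + 1) := by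
  induction k generalizing m with
  | zero =>
    interval_cases m <;> simp [imb]
  | succ k ihk =>
    induction m with
    | zero => simp [imb_zero_right]
    | succ m ihm =>
      rcases Nat.lt_or_ge k m with hm | hm
      · obtain rfl : m = k + 1 := by omega
        rw [imb_eq_zero (by omega)]
        have := Nat.choose_symm_of_eq_add (n := k + 1 + (k + 1 + 1)) (a := k + 1) (b := k + 1 + 1)
          rfl
        rw [this, sub_self]
      · rw [imb_odd_even_rec hm, ihk _ (by omega), ihm (by omega)]
        rw [show k + 1 + (m + 1) = k + m + 1 + 1 by ring, Nat.choose_succ_succ (k + m + 1) k,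
          Nat.choose_succ_succ (k + m + 1) (k + 1), show k + (m + 1) = k + m + 1 by ring,
          show k + 1 + m = k + m + 1 by ring]
        push_cast
        ring

theorem ballotNum_eq_choose_sub {n k : ℕ} (h : n ≤ 2 * k + 1) (hk : k ≤ n) :
    (ballotNum n k : ℤ) = (n.choose k : ℤ) - n.choose (k + 1) := by
  have h1 : ((n + 1 : ℕ) : ℤ) * n.choose k = (n + 1).choose (k + 1) * ((k + 1 : ℕ) : ℤ) := by
    exact_mod_cast Nat.add_one_mul_choose_eq n k
  have h2 : ((n + 1 : ℕ) : ℤ) * n.choose (k + 1) = (n + 1).choose (k + 1) * ((n - k : ℕ) : ℤ) := by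
    have := Nat.choose_mul_succ_eq n (k + 1)
    rw [show n + 1 - (k + 1) = n - k by omega] at this
    rw [mul_comm]
    exact_mod_cast this
  unfold ballotNum
  push_cast [Nat.cast_sub h]
  rw [Nat.cast_sub hk] at h2
  push_cast at h1 h2
  apply Int.ediv_eq_of_eq_mul_right (by omega)
  linarith

theorem ballotNum_eq_zero {n k : ℕ} (h : 2 * k + 1 ≤ n ∨ n < k) : ballotNum n k = 0 := by
  unfold ballotNum
  rcases h with h | h
  · simp [Nat.sub_eq_zero_of_le h]
  · simp [Nat.choose_eq_zero_of_lt (Nat.succ_lt_succ h)]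

theorem imb_eq_ballotNum {n k : ℕ} (hk : k ≤ n) :
    imb (2 * k + 1) (2 * (n - k)) = ballotNum n k := by
  rcases Nat.lt_or_ge (2 * k + 1) n with h | h
  · rw [imb_eq_zero (by omega), ballotNum_eq_zero (Or.inl h.le), Nat.cast_zero]
  · rw [imb_odd_even_eq_choose _ _ (by omega), ballotNum_eq_choose_sub h hk,
      show k + (n - k) = n by omega]

/-- Summary of a 321-avoiding permutation: `long` is the length of its longest increasing
subsequence, `short` the number of remaining letters, `free + tight` the largest `t` such that the
`t` smallest values appear in increasing order, and deleting the `j` smallest values for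
`j ≤ free + tight` shortens the longest increasing subsequence by `min j free`. -/
structure TailState where
  long : ℕ
  short : ℕ
  free : ℕ
  tight : ℕ

namespace TailState

/-- The summary of the permutation obtained by prepending a letter of value `p`. -/
def next (s : TailState) (p : ℕ) : TailState :=
  if p = 0 then ⟨s.long + 1, s.short, s.free + 1, s.tight⟩
  else if s.free = 0 then ⟨s.long + 1, s.short, 0, p⟩
  else ⟨s.long, s.short + 1, min p s.free - 1, p - min p s.free + 1⟩

/-- The inequalities satisfied by the summary of a permutation of length `n`. -/
def Valid (n : ℕ) (s : TailState) : Prop :=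
  s.long + s.short = n ∧ s.free + s.short ≤ s.long ∧ s.tight ≤ s.short

theorem Valid.next {n : ℕ} {s : TailState} (h : s.Valid n) {p : ℕ} (hp : p ≤ s.free + s.tight) :
    (s.next p).Valid (n + 1) := by
  obtain ⟨h1, h2, h3⟩ := h
  unfold TailState.next
  split_ifs <;> refine ⟨?_, ?_, ?_⟩ <;> simp only <;> omega

/-- Signed sum of `g` over the summaries reached by prepending one letter. -/
def transfer (g : TailState → ℤ) (s : TailState) : ℤ :=
  ∑ p ∈ Finset.range (s.free + s.tight + 1), (-1) ^ p * g (s.next p)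

/-- Signed sum of `g` over the summaries reached from the empty permutation in `n` steps. -/
def signedSum : ℕ → (TailState → ℤ) → ℤ
  | 0, g => g ⟨0, 0, 0, 0⟩
  | n + 1, g => signedSum n (transfer g)

theorem signedSum_congr {n : ℕ} {g g' : TailState → ℤ} (h : ∀ s, s.Valid n → g s = g' s) :
    signedSum n g = signedSum n g' := by
  induction n generalizing g g' with
  | zero => exact h _ ⟨rfl, le_rfl, le_rfl⟩
  | succ n ih =>
    refine ih fun s hs => Finset.sum_congr rfl fun p hp => ?_
    rw [h _ (hs.next (by simpa [Nat.lt_succ_iff] using hp))]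

theorem signedSum_zero (n : ℕ) : signedSum n (fun _ => 0) = 0 := by
  induction n with
  | zero => rfl
  | succ n ih =>
    rw [signedSum]
    refine Eq.trans (congrArg _ ?_) ih
    funext s
    simp [transfer]

theorem signedSum_eq_zero {n : ℕ} {g : TailState → ℤ} (h : ∀ s, s.Valid n → g s = 0) :
    signedSum n g = 0 := by
  rw [signedSum_congr h, signedSum_zero]

theorem signedSum_add (n : ℕ) (g g' : TailState → ℤ) :
    signedSum n (fun s => g s + g' s) = signedSum n g + signedSum n g' := by
  induction n generalizing g g' with
  | zero => rfl
  | succ n ih =>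
    rw [signedSum, signedSum, signedSum, ← ih]
    congr 1
    funext s
    simp [transfer, mul_add, Finset.sum_add_distrib]

theorem signedSum_const_mul (n : ℕ) (c : ℤ) (g : TailState → ℤ) :
    signedSum n (fun s => c * g s) = c * signedSum n g := by
  induction n generalizing g with
  | zero => rfl
  | succ n ih =>
    rw [signedSum, signedSum, ← ih]
    congr 1
    funext s
    simp [transfer, Finset.mul_sum, mul_left_comm]

/-- Indicator of a single summary. -/
noncomputable def exactInd (l q i j : ℕ) (s : TailState) : ℤ :=
  if s.long = l ∧ s.short = q ∧ s.free = i ∧ s.tight = j then 1 else 0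

/-- Indicator of the summaries with given `long` and `short` for which `i` is at most `free` (if
`j = 0`), respectively `free = i` and `j` is at most `tight` (if `j > 0`). -/
noncomputable def tailInd (l q i j : ℕ) (s : TailState) : ℤ :=
  if s.long = l ∧ s.short = q ∧ (if j = 0 then i ≤ s.free else s.free = i ∧ j ≤ s.tight)
  then 1 else 0

theorem transfer_exactInd (l q i j : ℕ) (s : TailState) :
    transfer (exactInd l q i j) s =
      (if s.long + 1 = l ∧ s.short = q ∧ s.free + 1 = i ∧ s.tight = j then 1 else 0) +
      (if 1 ≤ j ∧ s.long = l ∧ s.short + 1 = q ∧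
          (if j - 1 = 0 then i + 1 ≤ s.free else s.free = i + 1 ∧ j - 1 ≤ s.tight)
        then (-1) ^ (i + j) else 0) +
      (if 1 ≤ j ∧ s.long + 1 = l ∧ s.short = q ∧ s.free = 0 ∧ i = 0 ∧ j ≤ s.tight
        then (-1) ^ j else 0) := by
  have key : ∀ (c : ℕ) (P : Prop) (N : ℕ) (f : ℕ → ℤ), (∀ p ∈ Finset.range N,
      f p = if p = c then (if P then (-1) ^ (p + 1) else 0) else 0) →
      ∑ p ∈ Finset.range N, f p = if c < N ∧ P then (-1) ^ (c + 1) else 0 := by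
    intro c P N f h
    rw [Finset.sum_congr rfl h, Finset.sum_ite_eq']
    simp only [Finset.mem_range, ite_and]
  rw [transfer, Finset.sum_range_succ', add_comm, add_assoc]
  congr 1
  · simp [next, exactInd]
  · rcases Nat.eq_zero_or_pos s.free with h0 | h0
    · rw [key (j - 1) (1 ≤ j ∧ s.long + 1 = l ∧ s.short = q ∧ i = 0), if_neg (t := (-1) ^ (i + j)),
        zero_add]
      · by_cases hj : 1 ≤ j
        · rw [Nat.sub_add_cancel hj]
          congr 1
          simp only [eq_iff_iff]
          omega
        · rw [if_neg (by omega), if_neg (by omega)]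
      · split_ifs <;> omega
      · intro p hp
        simp only [next, exactInd, h0, if_true, Nat.succ_ne_zero, if_false]
        split_ifs <;> omega
    · rw [key (i + j - 1) (1 ≤ j ∧ s.long = l ∧ s.short + 1 = q ∧
          (if j - 1 = 0 then i + 1 ≤ s.free else s.free = i + 1 ∧ j - 1 ≤ s.tight)),
        if_neg (t := (-1) ^ j) (by omega), add_zero]
      · by_cases hj : 1 ≤ j
        · rw [Nat.sub_add_cancel (by omega)]
          congr 1
          simp only [eq_iff_iff]
          split_ifs <;> omega
        · rw [if_neg (by omega), if_neg (by omega)]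
      · intro p hp
        rw [Finset.mem_range] at hp
        simp only [next, exactInd, h0.ne', Nat.succ_ne_zero, if_false]
        split_ifs <;> omega

theorem signedSum_exactInd_zero {n l q i : ℕ} (h : l + q = n) :
    signedSum n (exactInd l q i 0) = if q = 0 ∧ i = l then 1 else 0 := by
  induction n generalizing l q i with
  | zero =>
    obtain ⟨rfl, rfl⟩ : l = 0 ∧ q = 0 := by omega
    simp [signedSum, exactInd, eq_comm]
  | succ n ih =>
    rw [signedSum]
    rcases l with _ | l
    · rw [signedSum_eq_zero, if_neg (by omega)]
      intro s hs
      simp [transfer_exactInd]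
    · rcases i with _ | i
      · rw [signedSum_eq_zero, if_neg (by omega)]
        intro s hs
        simp [transfer_exactInd]
      · rw [signedSum_congr (g' := exactInd l q i 0), ih (by omega)]
        · simp
        · intro s hs
          simp [transfer_exactInd, exactInd]

theorem neg_one_pow_mul_self (q : ℕ) : (-1 : ℤ) ^ q * (-1) ^ q = 1 := by
  rw [← mul_pow]; simp

/-- Closed form of the signed sum of `exactInd` for `0 < j`. -/
def exactVal (l q i j : ℕ) : ℤ :=
  if i + q ≤ l ∧ j ≤ q then
    (-1) ^ (q * (i + 1) + q + j) * imb l q * imb (l - i - 1) (q - j) else 0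

/-- Closed form of the signed sum of `tailInd`. -/
def tailVal (l q i j : ℕ) : ℤ :=
  if i + q ≤ l ∧ j ≤ q then (-1) ^ (q * (i + 1)) * imb l q * imb (l - i) (q - j) else 0

theorem tailVal_eq_zero {l q i j : ℕ} (h : ¬ (i + q ≤ l ∧ j ≤ q)) : tailVal l q i j = 0 :=
  if_neg h

theorem exactVal_eq_zero {l q i j : ℕ} (h : ¬ (i + q ≤ l ∧ j ≤ q)) : exactVal l q i j = 0 :=
  if_neg h

theorem tailVal_of_pos {l q i j : ℕ} (hj : 0 < j) :
    tailVal l q i j = exactVal l q i j + tailVal l q i (j + 1) := by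
  by_cases h : i + q ≤ l ∧ j ≤ q
  · obtain ⟨h1, h2⟩ := h
    rw [tailVal, exactVal, tailVal, if_pos ⟨h1, h2⟩, if_pos ⟨h1, h2⟩]
    rcases h2.lt_or_eq with h2 | rfl
    · rw [if_pos ⟨h1, h2⟩]
      obtain ⟨y, rfl⟩ := Nat.exists_eq_add_of_lt h2
      obtain ⟨x, rfl⟩ := Nat.exists_eq_add_of_lt (show i < l by omega)
      rw [show i + x + 1 - i = x + 1 by omega, show j + y + 1 - j = y + 1 by omega,
        show j + y + 1 - (j + 1) = y by omega, show x + 1 - 1 = x by omega,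
        imb_succ_succ (by omega : y ≤ x), show (j + y + 1) * (i + 1) + (j + y + 1) + j =
          (j + y + 1) * (i + 1) + (y + 1) + (j + j) by ring, pow_add _ _ (j + j),
        pow_add _ _ (y + 1), pow_add _ j j, neg_one_pow_mul_self]
      ring
    · rw [if_neg (by omega), Nat.sub_self, imb_zero_right, imb_zero_right,
        add_assoc, pow_add, pow_add, neg_one_pow_mul_self]
      ring
  · rw [tailVal_eq_zero h, exactVal_eq_zero h, tailVal_eq_zero (by omega), add_zero]

theorem tailVal_zero_right (l q i : ℕ) :
    tailVal l q i 0 =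
      (if q = 0 ∧ i = l then 1 else 0) + tailVal l q i 1 + tailVal l q (i + 1) 0 := by
  by_cases h : i + q ≤ l
  · rcases q with _ | q
    · rw [tailVal_eq_zero (j := 1) (by omega)]
      rcases h.lt_or_eq with h | rfl
      · rw [if_neg (by omega), tailVal, tailVal, if_pos (by omega), if_pos (by omega)]
        simp [imb_zero_right]
      · rw [tailVal_eq_zero (i := i + 1) (by omega), tailVal]
        simp [imb_zero_right]
    · rw [if_neg (by omega), tailVal, if_pos (by omega), tailVal, if_pos (by omega), zero_add]
      obtain ⟨x, rfl⟩ := Nat.exists_eq_add_of_lt (show i < l by omega)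
      rw [show i + x + 1 - i = x + 1 by omega, Nat.sub_zero, Nat.add_sub_cancel,
        imb_succ_succ (p := x) (by omega), tailVal]
      split_ifs with h'
      · rw [show i + x + 1 - (i + 1) = x by omega, Nat.sub_zero, mul_add (q + 1) (i + 1) 1, pow_add]
        ring
      · rw [imb_eq_zero (show x < q + 1 by omega)]
        ring
  · rw [if_neg (by omega), tailVal_eq_zero (by omega), tailVal_eq_zero (by omega),
      tailVal_eq_zero (by omega)]
    rfl

theorem exactVal_succ_succ_succ (l q i j : ℕ) :
    exactVal (l + 1) (q + 1) (i + 1) (j + 1) = exactVal l (q + 1) i (j + 1) +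
      (-1) ^ (i + 1 + (j + 1)) * tailVal (l + 1) q (i + 1 + 1) j := by
  unfold exactVal tailVal
  by_cases h : i + (q + 1) ≤ l ∧ j ≤ q
  · rw [if_pos (by omega), if_pos (by omega), if_pos (by omega), imb_succ_succ (by omega),
      show l + 1 - (i + 1) - 1 = l - i - 1 by omega, show l + 1 - (i + 1 + 1) = l - i - 1 by omega,
      Nat.add_sub_add_right]
    simp only [add_mul, mul_add, pow_add, mul_one, one_mul, pow_one]
    rcases neg_one_pow_eq_or ℤ (q * i) with h1 | h1 <;>
    rcases neg_one_pow_eq_or ℤ q with h2 | h2 <;>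
    rcases neg_one_pow_eq_or ℤ i with h3 | h3 <;>
    rcases neg_one_pow_eq_or ℤ j with h4 | h4 <;>
    rw [h1, h2, h3, h4] <;> ring
  · rw [if_neg (by omega), if_neg (by omega), if_neg (by omega)]
    ring

theorem exactVal_succ_succ_zero (l q j : ℕ) :
    exactVal (l + 1) (q + 1) 0 (j + 1) = (-1) ^ (j + 1) * tailVal (l + 1) q 1 j +
      (-1) ^ (j + 1) * tailVal l (q + 1) 0 (j + 1) := by
  unfold exactVal tailVal
  by_cases h : q ≤ l ∧ j ≤ q
  · rw [if_pos (by omega), if_pos (by omega), imb_succ_succ (by omega), Nat.add_sub_add_right,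
      Nat.sub_zero, Nat.add_sub_cancel, Nat.sub_zero]
    have key : (if 0 + (q + 1) ≤ l ∧ j + 1 ≤ q + 1 then
        (-1) ^ ((q + 1) * (0 + 1)) * imb l (q + 1) * imb l (q - j) else 0) =
        (-1) ^ ((q + 1) * (0 + 1)) * imb l (q + 1) * imb l (q - j) := by
      split_ifs with h'
      · rfl
      · rw [imb_eq_zero (show l < q + 1 by omega)]
        ring
    rw [key]
    simp only [add_mul, mul_add, pow_add, mul_one, pow_one, zero_add]
    rcases neg_one_pow_eq_or ℤ q with h2 | h2 <;>
    rcases neg_one_pow_eq_or ℤ j with h4 | h4 <;>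
    rw [h2, h4] <;> ring
  · rw [if_neg (by omega), if_neg (by omega), if_neg (by omega)]
    ring

theorem signedSum_tailInd_of_exactInd {n : ℕ}
    (h : ∀ l q i j, l + q = n → signedSum n (exactInd l q i (j + 1)) = exactVal l q i (j + 1))
    {l q : ℕ} (i j : ℕ) (hn : l + q = n) :
    signedSum n (tailInd l q i j) = tailVal l q i j := by
  have pos : ∀ d i j, q + 1 - j = d → signedSum n (tailInd l q i (j + 1)) = tailVal l q i (j + 1) := by
    intro d
    induction d with
    | zero =>
      intro i j hd
      rw [tailVal_eq_zero (by omega), signedSum_eq_zero]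
      intro s hs
      obtain ⟨h1, h2, h3⟩ := hs
      rw [tailInd, if_neg]
      simp only [Nat.succ_ne_zero, if_false]
      omega
    | succ d ih =>
      intro i j hd
      rw [tailVal_of_pos j.succ_pos, ← h l q i j hn, ← ih i (j + 1) (by omega), ← signedSum_add]
      congr 1
      funext s
      simp only [tailInd, exactInd, Nat.succ_ne_zero, if_false]
      split_ifs <;> omega
  rcases j with _ | j
  · have zero : ∀ d i, l + 1 - i = d → signedSum n (tailInd l q i 0) = tailVal l q i 0 := by
      intro d
      induction d with
      | zero =>
        intro i hd
        rw [tailVal_eq_zero (by omega), signedSum_eq_zero]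
        intro s hs
        obtain ⟨h1, h2, h3⟩ := hs
        rw [tailInd, if_neg]
        simp only [if_true]
        omega
      | succ d ih =>
        intro i hd
        rw [tailVal_zero_right, ← signedSum_exactInd_zero hn, ← pos _ i 0 rfl,
          ← ih (i + 1) (by omega), ← signedSum_add, ← signedSum_add]
        congr 1
        funext s
        simp only [tailInd, exactInd, Nat.succ_ne_zero, if_false, if_true, zero_add]
        split_ifs <;> omega
    exact zero _ i rfl
  · exact pos _ i j rfl

theorem signedSum_exactInd_succ {n l q : ℕ} (i j : ℕ) (hn : l + q = n) :
    signedSum n (exactInd l q i (j + 1)) = exactVal l q i (j + 1) := by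
  induction n generalizing l q i j with
  | zero =>
    rw [exactVal_eq_zero (by omega)]
    simp [signedSum, exactInd]
  | succ n ih =>
    have tail : ∀ {l q : ℕ} (i j : ℕ), l + q = n →
        signedSum n (tailInd l q i j) = tailVal l q i j :=
      signedSum_tailInd_of_exactInd fun l q i j => ih i j
    rw [signedSum]
    rcases q with _ | q
    · rw [exactVal_eq_zero (by omega), signedSum_eq_zero]
      rintro s ⟨h1, h2, h3⟩
      rw [transfer_exactInd, if_neg (by omega), if_neg (by omega), if_neg (by omega)]
      rfl
    rcases l with _ | l
    · rw [exactVal_eq_zero (by omega), signedSum_eq_zero]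
      rintro s ⟨h1, h2, h3⟩
      rw [transfer_exactInd, if_neg (by omega), if_neg, if_neg (by omega)]
      · rfl
      · split_ifs <;> omega
    rcases i with _ | i
    · rw [exactVal_succ_succ_zero, ← tail _ _ (by omega), ← tail _ _ (by omega),
        ← signedSum_const_mul, ← signedSum_const_mul, ← signedSum_add]
      congr 1
      funext s
      rw [transfer_exactInd, if_neg (by omega), zero_add]
      simp [tailInd]
    · rw [exactVal_succ_succ_succ, ← tail _ _ (by omega), ← ih _ _ (by omega),
        ← signedSum_const_mul, ← signedSum_add]
      congr 1
      funext s
      rw [transfer_exactInd]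
      simp [tailInd, exactInd]

theorem signedSum_long (n l q : ℕ) (hn : l + q = n) :
    signedSum n (fun s => if s.long = l then 1 else 0) = (-1) ^ q * imb l q ^ 2 := by
  rw [signedSum_congr (g' := tailInd l q 0 0), signedSum_tailInd_of_exactInd
    (fun l q i j => signedSum_exactInd_succ i j) _ _ hn, tailVal]
  · split_ifs with h
    · simp [sq, mul_assoc]
    · rw [imb_eq_zero (by omega)]
      simp
  · rintro s ⟨h1, h2, h3⟩
    simp only [tailInd, if_true]
    congr 1
    simp only [eq_iff_iff]
    omega

theorem signedSum_long_of_lt {n l : ℕ} (hn : n < l) :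
    signedSum n (fun s => if s.long = l then 1 else 0) = 0 := by
  refine signedSum_eq_zero ?_
  rintro s ⟨h1, h2, h3⟩
  rw [if_neg (by omega)]

end TailState

/-- The permutation whose word is `p` followed by the word of `σ`, with the values `≥ p` of `σ`
raised by one. -/
def prepend {n : ℕ} (p : Fin (n + 1)) (σ : Equiv.Perm (Fin n)) : Equiv.Perm (Fin (n + 1)) :=
  p.cycleRange⁻¹ * Equiv.Perm.decomposeFin.symm (0, σ)

section Prepend

variable {n : ℕ} (p : Fin (n + 1)) (σ : Equiv.Perm (Fin n))

@[simp]
theorem prepend_zero : prepend p σ 0 = p := by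
  simp [prepend, Equiv.Perm.inv_def]

@[simp]
theorem prepend_succ (i : Fin n) : prepend p σ i.succ = p.succAbove (σ i) := by
  simp [prepend, Equiv.Perm.inv_def]

theorem sign_prepend : Equiv.Perm.sign (prepend p σ) = (-1) ^ (p : ℕ) * Equiv.Perm.sign σ := by
  simp [prepend]

theorem prepend_bijective :
    Function.Bijective fun x : Fin (n + 1) × Equiv.Perm (Fin n) => prepend x.1 x.2 := by
  rw [Fintype.bijective_iff_injective_and_card]
  constructor
  · rintro ⟨p, σ⟩ ⟨p', σ'⟩ h
    have hp : p = p' := by simpa using DFunLike.congr_fun h 0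
    subst hp
    refine Prod.ext rfl (Equiv.ext fun i => ?_)
    simpa using DFunLike.congr_fun h i.succ
  · simp [Fintype.card_perm, Nat.factorial_succ]

/-- Every nonempty permutation is uniquely of the form `prepend p σ`. -/
noncomputable def prependEquiv (n : ℕ) :
    Fin (n + 1) × Equiv.Perm (Fin n) ≃ Equiv.Perm (Fin (n + 1)) :=
  Equiv.ofBijective _ prepend_bijective

@[simp]
theorem prependEquiv_apply (x : Fin (n + 1) × Equiv.Perm (Fin n)) :
    prependEquiv n x = prepend x.1 x.2 :=
  rfl

theorem prepend_succ_lt_prepend_succ {i j : Fin n} :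
    prepend p σ i.succ < prepend p σ j.succ ↔ σ i < σ j := by
  simp

theorem val_prepend_succ (i : Fin n) :
    (prepend p σ i.succ : ℕ) = if (σ i : ℕ) < p then (σ i : ℕ) else σ i + 1 := by
  rw [prepend_succ, Fin.succAbove]
  simp only [Fin.lt_def, Fin.val_castSucc]
  split_ifs <;> rfl

/-- The values of `σ` smaller than `t` appear in increasing order. -/
def InOrder (t : ℕ) (σ : Equiv.Perm (Fin n)) : Prop :=
  ∀ i j, i < j → (σ i : ℕ) < t → (σ j : ℕ) < t → σ i < σ j

/-- `σ` has an increasing subsequence of length at least `k` with all values at least `j`. -/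
def HasIncreasing (σ : Equiv.Perm (Fin n)) (j k : ℕ) : Prop :=
  ∃ s : Finset (Fin n), (∀ a ∈ s, ∀ b ∈ s, a < b → σ a < σ b) ∧ (∀ a ∈ s, j ≤ (σ a : ℕ)) ∧
    k ≤ s.card

variable {p σ}

theorem avoids321_prepend :
    Avoids321 (prepend p σ) ↔ Avoids321 σ ∧ InOrder p σ := by
  constructor
  · intro h
    refine ⟨?_, fun i j hij hi hj => ?_⟩
    · rintro ⟨i, j, k, hij, hjk, h1, h2⟩
      exact h ⟨i.succ, j.succ, k.succ, by simpa, by simpa, by simpa, by simpa⟩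
    · by_contra hlt
      have hne : σ i ≠ σ j := fun e => hij.ne (σ.injective e)
      have hji : σ j < σ i := lt_of_le_of_ne (not_lt.1 hlt) hne.symm
      refine h ⟨0, i.succ, j.succ, i.succ_pos, by simpa, by simpa, ?_⟩
      rw [Fin.lt_def, val_prepend_succ, if_pos hi, prepend_zero]
      exact hi
  · rintro ⟨h, ho⟩ ⟨i, j, k, hij, hjk, h1, h2⟩
    obtain ⟨j, rfl⟩ := Fin.exists_succ_eq.2 (Fin.ne_zero_of_lt hij)
    obtain ⟨k, rfl⟩ := Fin.exists_succ_eq.2 (Fin.ne_zero_of_lt hjk)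
    have hjk' : j < k := by simpa using hjk
    have h1' : σ k < σ j := by simpa using h1
    rcases Fin.eq_zero_or_eq_succ i with rfl | ⟨i, rfl⟩
    · rw [Fin.lt_def, val_prepend_succ, prepend_zero] at h2
      have hj : (σ j : ℕ) < p := by split_ifs at h2 <;> omega
      exact absurd (ho j k hjk' hj (lt_trans h1' hj)) h1'.not_gt
    · exact h ⟨i, j, k, by simpa using hij, hjk', h1', by simpa using h2⟩

theorem InOrder.mono {t t' : ℕ} (h : InOrder t σ) (ht : t' ≤ t) : InOrder t' σ :=
  fun i j hij hi hj => h i j hij (by omega) (by omega)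

theorem inOrder_prepend_zero {t : ℕ} :
    InOrder (t + 1) (prepend 0 σ) ↔ InOrder t σ := by
  constructor
  · intro h i j hij hi hj
    refine (prepend_succ_lt_prepend_succ 0 σ).1 (h i.succ j.succ (by simpa) ?_ ?_) <;>
      simpa [val_prepend_succ]
  · intro h i j hij hi hj
    obtain ⟨j, rfl⟩ := Fin.exists_succ_eq.2 (Fin.ne_zero_of_lt hij)
    rcases Fin.eq_zero_or_eq_succ i with rfl | ⟨i, rfl⟩
    · rw [Fin.lt_def, val_prepend_succ, prepend_zero]
      simp
    · rw [val_prepend_succ] at hi hj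
      rw [prepend_succ_lt_prepend_succ]
      exact h i j (by simpa using hij) (by simpa using hi) (by simpa using hj)

theorem inOrder_prepend_of_pos (hp : 0 < (p : ℕ)) (hσ : InOrder p σ) {t : ℕ} :
    InOrder t (prepend p σ) ↔ t ≤ p := by
  constructor
  · intro h
    by_contra! hlt
    have hn : (p : ℕ) - 1 < n := by omega
    set i := σ.symm ⟨p - 1, hn⟩ with hi
    have hv : (prepend p σ i.succ : ℕ) = p - 1 := by
      rw [val_prepend_succ]
      simp [hi, hp]
    have := h 0 i.succ i.succ_pos (by simpa using hlt) (by omega)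
    rw [Fin.lt_def, hv, prepend_zero] at this
    omega
  · intro h
    refine InOrder.mono (t := p) (fun i j hij hi hj => ?_) h
    obtain ⟨j, rfl⟩ := Fin.exists_succ_eq.2 (Fin.ne_zero_of_lt hij)
    rcases Fin.eq_zero_or_eq_succ i with rfl | ⟨i, rfl⟩
    · simp at hi
    · rw [val_prepend_succ] at hi hj
      rw [prepend_succ_lt_prepend_succ]
      refine hσ i j (by simpa using hij) ?_ ?_
      · split_ifs at hi <;> omega
      · split_ifs at hj <;> omega

theorem hasIncreasing_zero_right (j : ℕ) : HasIncreasing σ j 0 :=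
  ⟨∅, by simp⟩

theorem HasIncreasing.prepend {j j' k : ℕ} (h : HasIncreasing σ j k)
    (hj : ∀ i, j ≤ (σ i : ℕ) → j' ≤ (prepend p σ i.succ : ℕ)) :
    HasIncreasing (prepend p σ) j' k := by
  obtain ⟨s, h1, h2, h3⟩ := h
  refine ⟨s.map (Fin.succEmb n), ?_, ?_, by simpa⟩
  · simpa using h1
  · simpa using fun a ha => hj a (h2 a ha)

theorem HasIncreasing.prepend_cons {j k : ℕ} (h : HasIncreasing σ p k) (hj : j ≤ p) :
    HasIncreasing (_root_.prepend p σ) j (k + 1) := by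
  obtain ⟨s, h1, h2, h3⟩ := h
  have hv : ∀ a ∈ s, (p : ℕ) < _root_.prepend p σ a.succ := by
    intro a ha
    rw [val_prepend_succ, if_neg (h2 a ha).not_gt]
    exact Nat.lt_succ_of_le (h2 a ha)
  refine ⟨insert 0 (s.map (Fin.succEmb n)), ?_, ?_, ?_⟩
  · intro a ha b hb hab
    obtain ⟨b, rfl⟩ := Fin.exists_succ_eq.2 (Fin.ne_zero_of_lt hab)
    have hb : b ∈ s := by simpa [Fin.succ_ne_zero] using hb
    rcases Fin.eq_zero_or_eq_succ a with rfl | ⟨a, rfl⟩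
    · rw [prepend_zero, Fin.lt_def]
      exact hv b hb
    · have ha : a ∈ s := by simpa [Fin.succ_ne_zero] using ha
      rw [prepend_succ_lt_prepend_succ]
      exact h1 a ha b hb (by simpa using hab)
  · intro a ha
    rcases Fin.eq_zero_or_eq_succ a with rfl | ⟨a, rfl⟩
    · simpa using hj
    · have ha : a ∈ s := by simpa [Fin.succ_ne_zero] using ha
      exact hj.trans (hv a ha).le
  · rw [Finset.card_insert_of_notMem (by simp [Fin.succ_ne_zero]), Finset.card_map]
    omega

theorem HasIncreasing.of_prepend {j k : ℕ} (h : HasIncreasing (_root_.prepend p σ) j k) :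
    HasIncreasing σ (j - if (p : ℕ) < j then 1 else 0) k ∨ j ≤ p ∧ HasIncreasing σ p (k - 1) := by
  obtain ⟨s, h1, h2, h3⟩ := h
  have inc : ∀ a ∈ Finset.univ.filter (fun i : Fin n => i.succ ∈ s),
      ∀ b ∈ Finset.univ.filter (fun i : Fin n => i.succ ∈ s), a < b → σ a < σ b := by
    intro a ha b hb hab
    rw [← prepend_succ_lt_prepend_succ p]
    exact h1 _ (by simpa using ha) _ (by simpa using hb) (by simpa)
  have card := Fin.card_filter_univ_succ (fun i => i ∈ s)
  rw [Finset.filter_univ_mem] at card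
  by_cases h0 : 0 ∈ s
  · right
    refine ⟨by simpa using h2 0 h0, _, inc, ?_, ?_⟩
    · intro a ha
      have := h1 0 h0 _ (by simpa using ha) a.succ_pos
      rw [Fin.lt_def, val_prepend_succ, prepend_zero] at this
      split_ifs at this <;> omega
    · rw [if_pos h0] at card
      omega
  · left
    refine ⟨_, inc, ?_, ?_⟩
    · intro a ha
      have := h2 _ (by simpa using ha)
      rw [val_prepend_succ] at this
      split_ifs at this ⊢ <;> omega
    · rw [if_neg h0] at card
      omega

theorem hasIncreasing_prepend {j k : ℕ} (hj : j ≤ p) :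
    HasIncreasing (prepend p σ) j k ↔ HasIncreasing σ j k ∨ HasIncreasing σ p (k - 1) := by
  constructor
  · intro h
    rcases h.of_prepend with h | h
    · rw [if_neg hj.not_gt] at h
      exact Or.inl h
    · exact Or.inr h.2
  · rintro (h | h)
    · refine h.prepend fun i hi => ?_
      rw [val_prepend_succ]
      split_ifs <;> omega
    · rcases k with _ | k
      · exact hasIncreasing_zero_right j
      · exact h.prepend_cons hj

theorem hasIncreasing_succ_prepend_zero {j k : ℕ} :
    HasIncreasing (prepend 0 σ) (j + 1) k ↔ HasIncreasing σ j k := by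
  constructor
  · intro h
    rcases h.of_prepend with h | h
    · simpa using h
    · simp at h
  · intro h
    refine h.prepend fun i hi => ?_
    rw [val_prepend_succ]
    simpa using hi

end Prepend

/-- `s` summarizes `σ` in the sense of `TailState`. -/
structure Summarizes {n : ℕ} (s : TailState) (σ : Equiv.Perm (Fin n)) : Prop where
  valid : s.Valid n
  inOrder_iff : ∀ t ≤ n, InOrder t σ ↔ t ≤ s.free + s.tight
  hasIncreasing_iff : ∀ j ≤ s.free + s.tight, ∀ k, HasIncreasing σ j k ↔ k ≤ s.long - min j s.free

theorem Summarizes.prepend {n : ℕ} {s : TailState} {σ : Equiv.Perm (Fin n)} (h : Summarizes s σ)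
    {p : Fin (n + 1)} (hp : InOrder p σ) : Summarizes (s.next p) (prepend p σ) := by
  have hpt := (h.inOrder_iff p (by omega)).1 hp
  refine ⟨h.valid.next hpt, ?_, ?_⟩
  · intro t ht
    obtain ⟨h1, h2, h3⟩ := h.valid
    rcases Nat.eq_zero_or_pos (p : ℕ) with h0 | h0
    · obtain rfl : p = 0 := Fin.ext h0
      rcases t with _ | t
      · simp [InOrder]
      · rw [inOrder_prepend_zero, h.inOrder_iff t (by omega)]
        simp only [TailState.next, Fin.val_zero, if_true]
        omega
    · rw [inOrder_prepend_of_pos h0 hp]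
      unfold TailState.next
      split_ifs <;> simp only <;> omega
  · intro j hj k
    obtain ⟨h1, h2, h3⟩ := h.valid
    rcases Nat.eq_zero_or_pos (p : ℕ) with h0 | h0
    · obtain rfl : p = 0 := Fin.ext h0
      simp only [TailState.next, Fin.val_zero, if_true] at hj ⊢
      rcases j with _ | j
      · rw [hasIncreasing_prepend (by simp), Fin.val_zero, h.hasIncreasing_iff 0 (by omega),
          h.hasIncreasing_iff 0 (by omega)]
        omega
      · rw [hasIncreasing_succ_prepend_zero, h.hasIncreasing_iff j (by omega)]
        omega
    · have hjp : j ≤ p := by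
        revert hj
        unfold TailState.next
        split_ifs <;> simp only <;> omega
      rw [hasIncreasing_prepend hjp, h.hasIncreasing_iff j (by omega), h.hasIncreasing_iff p hpt]
      unfold TailState.next
      split_ifs <;> simp only <;> omega

/-- The summary of a permutation, computed by removing its letters from the left. -/
noncomputable def summary : (n : ℕ) → Equiv.Perm (Fin n) → TailState
  | 0, _ => ⟨0, 0, 0, 0⟩
  | n + 1, π => (summary n ((prependEquiv n).symm π).2).next ((prependEquiv n).symm π).1

theorem summary_prepend {n : ℕ} (p : Fin (n + 1)) (σ : Equiv.Perm (Fin n)) :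
    summary (n + 1) (prepend p σ) = (summary n σ).next p := by
  rw [summary, ← prependEquiv_apply (p, σ), Equiv.symm_apply_apply]

theorem summarizes_summary {n : ℕ} {π : Equiv.Perm (Fin n)} (hπ : Avoids321 π) :
    Summarizes (summary n π) π := by
  induction n with
  | zero =>
    refine ⟨⟨rfl, le_rfl, le_rfl⟩, fun t ht => ?_, fun j hj k => ?_⟩
    · simp [InOrder, summary, Nat.le_zero.1 ht]
    · simp [HasIncreasing, summary, Finset.eq_empty_of_isEmpty]
  | succ n ih =>
    obtain ⟨⟨p, σ⟩, rfl⟩ := (prependEquiv n).surjective π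
    simp only [prependEquiv_apply] at hπ ⊢
    rw [avoids321_prepend] at hπ
    rw [summary_prepend]
    exact (ih hπ.1).prepend hπ.2

theorem lis_eq_long {n : ℕ} {π : Equiv.Perm (Fin n)} (hπ : Avoids321 π) :
    lis π = (summary n π).long := by
  have h := (summarizes_summary hπ).hasIncreasing_iff 0 (Nat.zero_le _)
  simp only [Nat.zero_min, Nat.sub_zero] at h
  have le : ∀ s : Finset (Fin n), (∀ i ∈ s, ∀ j ∈ s, i < j → π i < π j) →
      s.card ≤ (summary n π).long := fun s hs => (h _).1 ⟨s, hs, by simp, le_rfl⟩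
  refine IsGreatest.csSup_eq ⟨?_, ?_⟩
  · obtain ⟨s, h1, -, h3⟩ := (h _).2 le_rfl
    exact ⟨s, h1, le_antisymm (le s h1) h3⟩
  · rintro k ⟨s, hs, rfl⟩
    exact le s hs

theorem sum_sign_mul_eq_signedSum (n : ℕ) (g : TailState → ℤ) :
    ∑ π : Equiv.Perm (Fin n),
      (if Avoids321 π then (Equiv.Perm.sign π : ℤ) * g (summary n π) else 0) =
      TailState.signedSum n g := by
  induction n generalizing g with
  | zero => simp [TailState.signedSum, Avoids321, summary]
  | succ n ih =>
    rw [TailState.signedSum, ← ih, ← (prependEquiv n).sum_comp, Fintype.sum_prod_type_right]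
    refine Finset.sum_congr rfl fun σ _ => ?_
    simp only [prependEquiv_apply, avoids321_prepend, summary_prepend, sign_prepend]
    by_cases hσ : Avoids321 σ
    · have hs := summarizes_summary hσ
      obtain ⟨h1, h2, h3⟩ := hs.valid
      simp only [hσ, true_and, if_true]
      have hin : ∀ p : Fin (n + 1), InOrder p σ ↔
          (p : ℕ) ≤ (summary n σ).free + (summary n σ).tight :=
        fun p => hs.inOrder_iff p (by omega)
      simp only [hin]
      rw [Fin.sum_univ_eq_sum_range (fun p => if p ≤ (summary n σ).free + (summary n σ).tight then
        (((-1) ^ p * Equiv.Perm.sign σ : ℤˣ) : ℤ) * g ((summary n σ).next p) else 0) (n + 1),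
        ← Finset.sum_filter, TailState.transfer, Finset.mul_sum]
      refine Finset.sum_congr ?_ fun p _ => ?_
      · ext p
        simp only [Finset.mem_filter, Finset.mem_range]
        omega
      · push_cast
        ring
    · simp [hσ]

theorem eCount_sub_oCount (n l : ℕ) :
    (eCount n l : ℤ) - oCount n l =
      TailState.signedSum n (fun s => if s.long = l then 1 else 0) := by
  rw [← sum_sign_mul_eq_signedSum, eCount, oCount, Nat.card_eq_fintype_card,
    Nat.card_eq_fintype_card, Fintype.card_subtype, Fintype.card_subtype, Finset.card_filter,
    Finset.card_filter]
  push_cast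
  rw [← Finset.sum_sub_distrib]
  refine Finset.sum_congr rfl fun π _ => ?_
  by_cases hπ : Avoids321 π
  · simp only [hπ, true_and, if_true, lis_eq_long hπ]
    rcases Int.units_eq_one_or (Equiv.Perm.sign π) with h | h <;> simp [h, apply_ite]
  · simp [hπ]

theorem e_sub_o_odd_odd (n k : ℕ) :
    (eCount (2 * n + 1) (2 * k + 1) : ℤ) - (oCount (2 * n + 1) (2 * k + 1) : ℤ)
      = (ballotNum n k : ℤ) ^ 2 := by
  rw [eCount_sub_oCount]
  rcases Nat.lt_or_ge n k with h | h
  · rw [TailState.signedSum_long_of_lt (by omega), ballotNum_eq_zero (Or.inr h)]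
    rfl
  · rw [TailState.signedSum_long _ _ (2 * (n - k)) (by omega), imb_eq_ballotNum h,
      pow_mul, neg_one_sq, one_pow, one_mul]
end
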